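/- Let d and k be positive integers, let φ : {1,…,k} → ℝ^d satisfy ‖φ_i‖₂ ≤ 1 for all i, and define Λ_j = I + Σ_{i=1}^{j} φ_i φ_iᵀ for 0 ≤ j ≤ k. Then for every τ > 0, the number of indices i ∈ {1,…,k} with φ_iᵀ (Λ_{i-1})⁻¹ φ_i ≥ τ is at most (2d/τ) · log( k/d + 1 ). -/

import Mathlib

open Matrix BigOperators
open scoped Classical

/-- The regularized Gram matrix `Λ_j = I + ∑_{i=1}^{j} φ_i φ_iᵀ`. -/
noncomputable def gramMat (d k : ℕ) (φ : Fin k → Fin d → ℝ) (j : ℕ) :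
    Matrix (Fin d) (Fin d) ℝ :=
  1 + ∑ i : Fin k, if (i : ℕ) < j then vecMulVec (φ i) (φ i) else 0

lemma gram_psd (d k : ℕ) (φ : Fin k → Fin d → ℝ) (j : ℕ) :
    (∑ i : Fin k, if (i : ℕ) < j then vecMulVec (φ i) (φ i) else 0 :
      Matrix (Fin d) (Fin d) ℝ).PosSemidef := by
  apply Matrix.posSemidef_sum
  intro i _
  split_ifs
  · simpa using Matrix.posSemidef_vecMulVec_self_star (φ i)
  · exact Matrix.PosSemidef.zero

lemma gram_pd (d k : ℕ) (φ : Fin k → Fin d → ℝ) (j : ℕ) :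
    (gramMat d k φ j).PosDef :=
  Matrix.PosDef.one.add_posSemidef (gram_psd d k φ j)

lemma gram_succ (d k : ℕ) (φ : Fin k → Fin d → ℝ) (i : Fin k) :
    gramMat d k φ ((i : ℕ) + 1) = gramMat d k φ i + vecMulVec (φ i) (φ i) := by
  unfold gramMat
  rw [add_assoc]
  congr 1
  have h : vecMulVec (φ i) (φ i) = ∑ l : Fin k, if l = i then vecMulVec (φ l) (φ l) else 0 := by
    simp
  rw [h, ← Finset.sum_add_distrib]
  refine Finset.sum_congr rfl fun l _ => ?_
  by_cases h1 : l = i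
  · subst h1; simp
  · have h2 : (l : ℕ) ≠ i := fun h => h1 (Fin.ext h)
    by_cases h3 : (l : ℕ) < i
    · simp [h1, h3, Nat.lt_succ_of_lt h3]
    · have : ¬ (l : ℕ) < i + 1 := by omega
      simp only [h1, h3, this, if_false, add_zero]

lemma gram_det (d k : ℕ) (φ : Fin k → Fin d → ℝ) (i : Fin k) :
    (gramMat d k φ ((i : ℕ) + 1)).det = (gramMat d k φ i).det *
      (1 + φ i ⬝ᵥ (gramMat d k φ (i : ℕ))⁻¹.mulVec (φ i)) := by
  have hu : IsUnit (gramMat d k φ i).det := (gram_pd d k φ i).det_pos.ne'.isUnit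
  rw [gram_succ, vecMulVec_eq Unit, det_add_replicateCol_mul_replicateRow hu]
  congr 1
  rw [det_unique]
  simp [Matrix.mul_apply, dotProduct, mulVec, Finset.sum_mul, Finset.mul_sum]
  rw [Finset.sum_comm]
  simp [mul_assoc]

lemma q_bounds (d k : ℕ) (φ : Fin k → Fin d → ℝ) (i : Fin k) 
    (hφ : Real.sqrt (∑ j, (φ i j) ^ 2) ≤ 1) (j : ℕ) :
    0 ≤ φ i ⬝ᵥ (gramMat d k φ j)⁻¹.mulVec (φ i) ∧
      φ i ⬝ᵥ (gramMat d k φ j)⁻¹.mulVec (φ i) ≤ 1 := by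
  have hu : IsUnit (gramMat d k φ j).det := (gram_pd d k φ j).det_pos.ne'.isUnit
  set x := (gramMat d k φ j)⁻¹.mulVec (φ i) with hx
  have h1 : φ i = (gramMat d k φ j).mulVec x := by
    rw [hx, mulVec_mulVec, Matrix.mul_nonsing_inv _ hu, one_mulVec]
  have h2 : x ⬝ᵥ x ≤ φ i ⬝ᵥ x := by
    have := (gram_psd d k φ j).dotProduct_mulVec_nonneg x
    rw [dotProduct_comm (φ i), h1, gramMat, add_mulVec, one_mulVec, dotProduct_add]
    simp only [star_trivial] at this
    linarith
  have h3 : φ i ⬝ᵥ φ i ≤ 1 := by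
    rw [Real.sqrt_le_one] at hφ
    simpa [dotProduct, pow_two] using hφ
  have h4 : 0 ≤ x ⬝ᵥ x := by simpa using dotProduct_star_self_nonneg x
  have h5 : 0 ≤ (φ i - x) ⬝ᵥ (φ i - x) := by simpa using dotProduct_star_self_nonneg (φ i - x)
  rw [sub_dotProduct, dotProduct_sub, dotProduct_sub, dotProduct_comm x (φ i)] at h5
  constructor <;> linarith

lemma log_det_sum (d k : ℕ) (φ : Fin k → Fin d → ℝ)
    (hφ : ∀ i : Fin k, Real.sqrt (∑ j, (φ i j) ^ 2) ≤ 1) :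
    Real.log (gramMat d k φ k).det =
      ∑ i : Fin k, Real.log (1 + φ i ⬝ᵥ (gramMat d k φ (i : ℕ))⁻¹.mulVec (φ i)) := by
  have h : ∀ i : Fin k, Real.log (1 + φ i ⬝ᵥ (gramMat d k φ (i : ℕ))⁻¹.mulVec (φ i)) =
      Real.log (gramMat d k φ ((i : ℕ) + 1)).det - Real.log (gramMat d k φ (i : ℕ)).det := by
    intro i
    have := (q_bounds d k φ i (hφ i) i).1
    rw [gram_det, Real.log_mul (gram_pd d k φ i).det_pos.ne' (by positivity)]
    ring
  rw [Finset.sum_congr rfl fun i _ => h i,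
    Fin.sum_univ_eq_sum_range (fun n => Real.log (gramMat d k φ (n + 1)).det -
      Real.log (gramMat d k φ n).det) k,
    Finset.sum_range_sub (fun n => Real.log (gramMat d k φ n).det)]
  simp [gramMat]

lemma log_det_le (d k : ℕ) (hd : 0 < d) (φ : Fin k → Fin d → ℝ)
    (hφ : ∀ i : Fin k, Real.sqrt (∑ j, (φ i j) ^ 2) ≤ 1) :
    Real.log (gramMat d k φ k).det ≤ d * Real.log ((k : ℝ) / d + 1) := by
  have hpd := gram_pd d k φ k
  have hd' : (0 : ℝ) < d := by exact_mod_cast hd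
  set c : ℝ := (k : ℝ) / d + 1 with hc
  have hcpos : 0 < c := by positivity
  have htr : (gramMat d k φ k).trace ≤ d * c := by
    have : (d : ℝ) * c = d + ∑ _i : Fin k, (1 : ℝ) := by
      simp [hc]; field_simp; ring
    rw [this, gramMat, trace_add, trace_one, trace_sum]
    simp only [Fintype.card_fin, Fin.is_lt, if_true, trace_vecMulVec]
    gcongr with i _
    have := hφ i
    rw [Real.sqrt_le_one] at this
    simpa [dotProduct, pow_two] using this
  rw [hpd.isHermitian.trace_eq_sum_eigenvalues] at htr
  rw [hpd.isHermitian.det_eq_prod_eigenvalues]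
  simp only [RCLike.ofReal_real_eq_id, id] at htr ⊢
  rw [Real.log_prod (fun i _ => (hpd.eigenvalues_pos i).ne')]
  have h : ∀ i, Real.log (hpd.isHermitian.eigenvalues i) ≤
      hpd.isHermitian.eigenvalues i / c - 1 + Real.log c := by
    intro i
    have hp := hpd.eigenvalues_pos i
    have := Real.log_le_sub_one_of_pos (div_pos hp hcpos)
    rw [Real.log_div hp.ne' hcpos.ne'] at this
    linarith
  refine (Finset.sum_le_sum fun i _ => h i).trans ?_
  rw [Finset.sum_add_distrib, Finset.sum_sub_distrib, ← Finset.sum_div]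
  simp only [Finset.sum_const, Finset.card_univ, Fintype.card_fin, nsmul_eq_mul, mul_one]
  have := (div_le_iff₀ hcpos).2 htr
  linarith

/-- The number of indices `i` with `φ_iᵀ (Λ_{i-1})⁻¹ φ_i ≥ τ` is at most
`(2d/τ) log(k/d + 1)`. -/
theorem stmt_9 (d k : ℕ) (hd : 0 < d) (hk : 0 < k)
    (φ : Fin k → Fin d → ℝ)
    (hφ : ∀ i : Fin k, Real.sqrt (∑ j, (φ i j) ^ 2) ≤ 1)
    (τ : ℝ) (hτ : 0 < τ) :
    ((Finset.univ.filter fun i : Fin k =>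
        τ ≤ φ i ⬝ᵥ (gramMat d k φ (i : ℕ))⁻¹.mulVec (φ i)).card : ℝ)
      ≤ (2 * d / τ) * Real.log ((k : ℝ) / d + 1) := by
  have h1 := log_det_le d k hd φ hφ
  rw [log_det_sum d k φ hφ] at h1
  have hq := fun i => q_bounds d k φ i (hφ i) i
  set q : Fin k → ℝ := fun i => φ i ⬝ᵥ (gramMat d k φ (i : ℕ))⁻¹.mulVec (φ i) with hqdef
  have h2 : ∀ i, q i ≤ 2 * Real.log (1 + q i) := by
    intro i
    have h0 : 0 ≤ q i := (hq i).1
    have h0' : q i ≤ 1 := (hq i).2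
    have hl := Real.one_sub_inv_le_log_of_pos (show 0 < 1 + q i by linarith)
    have : q i / 2 ≤ 1 - (1 + q i)⁻¹ := by
      have hp : 0 < 1 + q i := by linarith
      have e : 1 - (1 + q i)⁻¹ = q i / (1 + q i) := by field_simp; ring
      rw [e]
      gcongr
      linarith
    linarith
  have h3 : ((Finset.univ.filter fun i : Fin k => τ ≤ q i).card : ℝ) * τ ≤ ∑ i, q i := by
    rw [← nsmul_eq_mul]
    refine (Finset.card_nsmul_le_sum _ q τ (by simp)).trans ?_
    exact Finset.sum_le_sum_of_subset_of_nonneg (Finset.filter_subset _ _)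
      (fun i _ _ => (hq i).1)
  have h4 : ∑ i, q i ≤ 2 * ∑ i, Real.log (1 + q i) := by
    rw [Finset.mul_sum]
    exact Finset.sum_le_sum fun i _ => h2 i
  rw [div_mul_eq_mul_div, le_div_iff₀ hτ]
  refine h3.trans (h4.trans ?_)
  rw [mul_assoc]
  exact mul_le_mul_of_nonneg_left h1 (by norm_num)
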